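/- Let C be an evolutionary stable configuration on an m×n grid with m > 2 and n > 2. Then n is divisible by 3, m is odd, and the occupancy of C equals |C| = mn − (m−1)(2n−3)/6 = (2/3)mn + (m−1)/2 + n/3. Moreover, the rows m−1−2k (for k ≥ 0 with m−1−2k ≥ 1) are exactly the pattern with C_{i,j} = 0 iff j ≡ 2 (mod 3), the bottom row m is fully occupied, and in each remaining row i = m−2k (k ≥ 1) the lots in columns 1, n, and all columns j ≡ 2 (mod 3) are occupied, while for each pair of adjacent columns (3l, 3l+1) with 1 ≤ l ≤ (n−3)/3 exactly one of the two lots in row i is occupied and the other is empty. -/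

import Mathlib

/-- Occupied lot `(i,j)` receives sunlight: the lot to its west, east or south
lies outside the `m × n` grid or is empty. -/
def Sun2 (m n : ℕ) (C : ℕ → ℕ → Bool) (i j : ℕ) : Prop :=
  (j = 1 ∨ C i (j - 1) = false) ∨ (j = n ∨ C i (j + 1) = false) ∨
    (i = m ∨ C (i + 1) j = false)

/-- Every occupied lot of the `m × n` grid receives sunlight. -/
def Permissible2 (m n : ℕ) (C : ℕ → ℕ → Bool) : Prop :=
  ∀ i j, 1 ≤ i → i ≤ m → 1 ≤ j → j ≤ n → C i j = true → Sun2 m n C i j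

/-- The configuration obtained by occupying lot `(i,j)`. -/
def occupy2 (C : ℕ → ℕ → Bool) (i j : ℕ) : ℕ → ℕ → Bool :=
  fun a b => if a = i ∧ b = j then true else C a b

/-- Maximal: permissible, and occupying any empty lot breaks permissibility. -/
def IsMaximal2 (m n : ℕ) (C : ℕ → ℕ → Bool) : Prop :=
  Permissible2 m n C ∧ ∀ i j, 1 ≤ i → i ≤ m → 1 ≤ j → j ≤ n → C i j = false →
    ¬ Permissible2 m n (occupy2 C i j)

/-- Resistant to predators: a house built on any empty lot would get no sunlight. -/
def ResistPred2 (m n : ℕ) (C : ℕ → ℕ → Bool) : Prop :=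
  ∀ i j, 1 ≤ i → i ≤ m → 1 ≤ j → j ≤ n → C i j = false →
    ¬ Sun2 m n (occupy2 C i j) i j

/-- Resistant to altruists: a house built on any empty lot would cut off sunlight
from some other occupied lot. -/
def ResistAlt2 (m n : ℕ) (C : ℕ → ℕ → Bool) : Prop :=
  ∀ i j, 1 ≤ i → i ≤ m → 1 ≤ j → j ≤ n → C i j = false →
    ∃ a b, 1 ≤ a ∧ a ≤ m ∧ 1 ≤ b ∧ b ≤ n ∧ (a, b) ≠ (i, j) ∧ C a b = true ∧
      ¬ Sun2 m n (occupy2 C i j) a b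

/-- Number of occupied lots in row `i`. -/
def rowOcc (n : ℕ) (C : ℕ → ℕ → Bool) (i : ℕ) : ℕ :=
  ((Finset.Icc 1 n).filter (fun j => C i j = true)).card

/-- Total number of occupied lots. -/
def totalOcc (m n : ℕ) (C : ℕ → ℕ → Bool) : ℕ :=
  ∑ i ∈ Finset.Icc 1 m, rowOcc n C i

structure ESZ (n : ℤ) (M : ℕ) (E : ℕ → ℤ → Prop) : Prop where
  dom : ∀ h j, E h j → 2 ≤ j ∧ j ≤ n - 1 ∧ 1 ≤ h ∧ h ≤ M
  adj : ∀ h j, E h j → ¬ E h (j + 1)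
  sou : ∀ h j, E h j → ¬ E (h + 1) j
  sun : ∀ h j, h + 1 ≤ M → 2 ≤ j → j ≤ n - 1 → ¬ E (h + 1) j →
    E (h + 1) (j - 1) ∨ E (h + 1) (j + 1) ∨ E h j
  alt : ∀ h j, E (h + 1) j → (3 ≤ j ∧ ¬ E (h + 1) (j - 2) ∧ ¬ E h (j - 1)) ∨
    (j ≤ n - 2 ∧ ¬ E (h + 1) (j + 2) ∧ ¬ E h (j + 1)) ∨
    (h + 2 ≤ M ∧ ¬ E (h + 2) (j - 1) ∧ ¬ E (h + 2) (j + 1))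

structure RepZ (n : ℤ) (E : ℕ → ℤ → Prop) (h : ℕ) (p q : ℤ) (y : ℤ → ℤ) : Prop where
  le : p ≤ q
  mem : ∀ i, p ≤ i → i ≤ q → E h (y i)
  ex : ∀ j, E h j → ∃ i, p ≤ i ∧ i ≤ q ∧ y i = j
  lo : ∀ i, p ≤ i → i < q → y i + 2 ≤ y (i + 1)
  hi : ∀ i, p ≤ i → i < q → y (i + 1) ≤ y i + 4
  lb : y p ≤ 4
  rb : n - 3 ≤ y q

theorem locZ (y : ℤ → ℤ) (p q j : ℤ) (hpq : p ≤ q) (h1 : y p ≤ j) (h2 : j < y q) :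
    ∃ i, p ≤ i ∧ i < q ∧ y i ≤ j ∧ j < y (i + 1) := by
  induction q, hpq using Int.leInduction with
  | base => omega
  | succ q hq ih =>
    by_cases hj : j < y q
    · obtain ⟨i, a, b, c, d⟩ := ih hj
      exact ⟨i, a, by omega, c, d⟩
    · exact ⟨q, hq, by omega, by omega, h2⟩

theorem slopeZ (y : ℤ → ℤ) (d p q : ℤ) (H : ∀ i, p ≤ i → i < q → y i + d ≤ y (i + 1))
    (a b : ℤ) (hab : a ≤ b) (ha : p ≤ a) (hb : b ≤ q) : y a + d * (b - a) ≤ y b := by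
  induction b, hab using Int.leInduction with
  | base => simp
  | succ b hq ih =>
    have := ih (by omega)
    have := H b (by omega) (by omega)
    have e : d * (b + 1 - a) = d * (b - a) + d := by ring
    omega

theorem slopeZ' (y : ℤ → ℤ) (d p q : ℤ) (H : ∀ i, p ≤ i → i < q → y (i + 1) ≤ y i + d)
    (a b : ℤ) (hab : a ≤ b) (ha : p ≤ a) (hb : b ≤ q) : y b ≤ y a + d * (b - a) := by
  induction b, hab using Int.leInduction with
  | base => simp
  | succ b hq ih =>
    have := ih (by omega)
    have := H b (by omega) (by omega)
    have e : d * (b + 1 - a) = d * (b - a) + d := by ring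
    omega

/-- middle zero -/
theorem midZ {n : ℤ} {M : ℕ} {E : ℕ → ℤ → Prop} (S : ESZ n M E) {h : ℕ} {a b : ℤ}
    (hM : h + 1 ≤ M) (Ea : E h a) (Eb : E h b) (l : a + 2 ≤ b) (u : b ≤ a + 4)
    (H : ∀ j, a < j → j < b → ¬ E h j) :
    ∃ x, (x = a + 1 ∨ x = a + 2) ∧ x < b ∧ b ≤ x + 2 ∧ E (h + 1) x ∧
      ∀ j, a < j → j < b → E (h + 1) j → j = x := by
  have da := S.dom _ _ Ea
  have db := S.dom _ _ Eb
  have na := S.sou _ _ Ea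
  have nb := S.sou _ _ Eb
  have sn : ∀ j, a < j → j < b → ¬ E (h + 1) j → E (h + 1) (j - 1) ∨ E (h + 1) (j + 1) := by
    intro j h1 h2 h3
    have := S.sun h j hM (by omega) (by omega) h3
    have := H j h1 h2
    tauto
  have hb : b = a + 2 ∨ b = a + 3 ∨ b = a + 4 := by omega
  rcases hb with rfl | rfl | rfl
  · have e1 : E (h + 1) (a + 1) := by
      by_contra hc
      have := sn _ (by omega) (by omega) hc
      rw [show a + 1 - 1 = a by ring, show a + 1 + 1 = a + 2 by ring] at this
      tauto
    exact ⟨a + 1, by omega, by omega, by omega, e1, by intros; omega⟩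
  · by_cases h1 : E (h + 1) (a + 1)
    · have := S.adj _ _ h1
      rw [show a + 1 + 1 = a + 2 by ring] at this
      refine ⟨a + 1, by omega, by omega, by omega, h1, ?_⟩
      intro j j1 j2 j3
      have : j = a + 1 ∨ j = a + 2 := by omega
      rcases this with rfl | rfl <;> tauto
    · have := sn _ (by omega) (by omega) h1
      rw [show a + 1 - 1 = a by ring, show a + 1 + 1 = a + 2 by ring] at this
      refine ⟨a + 2, by omega, by omega, by omega, by tauto, ?_⟩
      intro j j1 j2 j3
      have : j = a + 1 ∨ j = a + 2 := by omega
      rcases this with rfl | rfl <;> tauto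
  · have s1 := sn (a + 1) (by omega) (by omega)
    have s2 := sn (a + 2) (by omega) (by omega)
    have s3 := sn (a + 3) (by omega) (by omega)
    rw [show a + 1 - 1 = a by ring, show a + 1 + 1 = a + 2 by ring] at s1
    rw [show a + 2 - 1 = a + 1 by ring, show a + 2 + 1 = a + 3 by ring] at s2
    rw [show a + 3 - 1 = a + 2 by ring, show a + 3 + 1 = a + 4 by ring] at s3
    by_cases h2 : E (h + 1) (a + 2)
    · have t3 := S.adj _ _ h2
      have t1 := S.adj (h + 1) (a + 1)
      rw [show a + 2 + 1 = a + 3 by ring] at t3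
      rw [show a + 1 + 1 = a + 2 by ring] at t1
      refine ⟨a + 2, by omega, by omega, by omega, h2, ?_⟩
      intro j j1 j2 j3
      have : j = a + 1 ∨ j = a + 2 ∨ j = a + 3 := by omega
      rcases this with rfl | rfl | rfl
      · exact absurd h2 (t1 j3)
      · rfl
      · exact absurd j3 t3
    · exfalso
      have h1 : E (h + 1) (a + 1) := by
        by_contra hc
        rcases s1 hc with t | t
        · exact na t
        · exact h2 t
      have h3 : E (h + 1) (a + 3) := by
        by_contra hc
        rcases s3 hc with t | t
        · exact h2 t
        · exact nb t
      have g1 := S.alt _ _ h1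
      have g3 := S.alt _ _ h3
      rw [show a + 1 - 2 = a - 1 by ring, show a + 1 - 1 = a by ring,
        show a + 1 + 2 = a + 3 by ring, show a + 1 + 1 = a + 2 by ring] at g1
      rw [show a + 3 - 2 = a + 1 by ring, show a + 3 - 1 = a + 2 by ring,
        show a + 3 + 2 = a + 5 by ring, show a + 3 + 1 = a + 4 by ring] at g3
      have k1 : h + 2 ≤ M ∧ ¬ E (h + 2) (a + 2) := by
        rcases g1 with t | t | t
        · exact absurd Ea t.2.2
        · exact absurd h3 t.2.1
        · exact ⟨t.1, t.2.2⟩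
      have := S.sun (h + 1) (a + 2) k1.1 (by omega) (by omega) k1.2
      have u1 := S.sou _ _ h1
      have u3 := S.sou _ _ h3
      rw [show a + 2 - 1 = a + 1 by ring, show a + 2 + 1 = a + 3 by ring] at this
      rcases this with t | t | t
      · exact u1 t
      · exact u3 t
      · exact h2 t

theorem leftZ {n : ℤ} {M : ℕ} {E : ℕ → ℤ → Prop} (S : ESZ n M E) {h : ℕ} {b : ℤ}
    (hM : h + 1 ≤ M) (Eb : E h b) (l : 3 ≤ b) (u : b ≤ 4)
    (H : ∀ j, j < b → ¬ E h j) :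
    ∃ x, 2 ≤ x ∧ x < b ∧ b ≤ x + 2 ∧ E (h + 1) x ∧
      ∀ j, j < b → E (h + 1) j → j = x := by
  have db := S.dom _ _ Eb
  have nb := S.sou _ _ Eb
  have n1 : ¬ E (h + 1) 1 := fun hc => by have := S.dom _ _ hc; omega
  have s2 := S.sun h 2 hM (by omega) (by omega)
  have s3 := S.sun h 3 hM (by omega) (by omega)
  have H2 := H 2 (by omega)
  have a2 := S.adj (h + 1) 2
  norm_num at s2 s3 a2
  have hb : b = 3 ∨ b = 4 := by omega
  rcases hb with rfl | rfl
  · have e1 : E (h + 1) 2 := by tauto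
    refine ⟨2, by omega, by omega, by omega, e1, ?_⟩
    intro j hj hj2
    have := S.dom _ _ hj2
    omega
  · have H3 := H 3 (by omega)
    by_cases h2 : E (h + 1) 2
    · refine ⟨2, by omega, by omega, by omega, h2, ?_⟩
      intro j hj hj2
      have := S.dom _ _ hj2
      have : j = 2 ∨ j = 3 := by omega
      rcases this with rfl | rfl <;> tauto
    · refine ⟨3, by omega, by omega, by omega, by tauto, ?_⟩
      intro j hj hj2
      have := S.dom _ _ hj2
      have : j = 2 ∨ j = 3 := by omega
      rcases this with rfl | rfl <;> tauto

theorem ESZ.refl {n : ℤ} {M : ℕ} {E : ℕ → ℤ → Prop} (S : ESZ n M E) :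
    ESZ n M (fun h j => E h (n + 1 - j)) where
  dom := by
    intro h j hj
    have := S.dom _ _ hj
    omega
  adj := by
    intro h j h1 h2
    have := S.adj _ _ h2
    rw [show n + 1 - (j + 1) + 1 = n + 1 - j by ring] at this
    exact this h1
  sou := fun h j => S.sou h _
  sun := by
    intro h j h1 h2 h3 h4
    have := S.sun h (n + 1 - j) h1 (by omega) (by omega) h4
    simp only [show n + 1 - (j - 1) = n + 1 - j + 1 by ring,
      show n + 1 - (j + 1) = n + 1 - j - 1 by ring]
    tauto
  alt := by
    intro h j h1
    have := S.alt h (n + 1 - j) h1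
    simp only [show n + 1 - (j - 1) = n + 1 - j + 1 by ring,
      show n + 1 - (j + 1) = n + 1 - j - 1 by ring,
      show n + 1 - (j - 2) = n + 1 - j + 2 by ring,
      show n + 1 - (j + 2) = n + 1 - j - 2 by ring]
    rcases this with ⟨a, b, c⟩ | ⟨a, b, c⟩ | ⟨a, b, c⟩
    · right; left; exact ⟨by omega, b, c⟩
    · left; exact ⟨by omega, b, c⟩
    · right; right; exact ⟨a, c, b⟩

theorem rightZ {n : ℤ} {M : ℕ} {E : ℕ → ℤ → Prop} (S : ESZ n M E) {h : ℕ} {b : ℤ}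
    (hM : h + 1 ≤ M) (Eb : E h b) (l : b ≤ n - 2) (u : n - 3 ≤ b)
    (H : ∀ j, b < j → ¬ E h j) :
    ∃ x, x ≤ n - 1 ∧ b < x ∧ x ≤ b + 2 ∧ E (h + 1) x ∧
      ∀ j, b < j → E (h + 1) j → j = x := by
  obtain ⟨x, h1, h2, h3, h4, h5⟩ := leftZ S.refl (h := h) (b := n + 1 - b) hM
    (by simpa using Eb) (by omega) (by omega) (fun j hj => H _ (by omega))
  refine ⟨n + 1 - x, by omega, by omega, by omega, h4, ?_⟩
  intro j hj hE
  have := h5 (n + 1 - j) (by omega) (by simpa using hE)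
  omega

theorem RepZ.bet {n : ℤ} {E : ℕ → ℤ → Prop} {h : ℕ} {p q : ℤ} {y : ℤ → ℤ}
    (R : RepZ n E h p q y) (i : ℤ) (h1 : p ≤ i) (h2 : i < q) (j : ℤ) (a : y i < j)
    (b : j < y (i + 1)) : ¬ E h j := by
  intro hE
  obtain ⟨k, k1, k2, rfl⟩ := R.ex j hE
  by_cases hk : k ≤ i
  · have := slopeZ y 2 p q R.lo k i hk k1 (by omega)
    omega
  · have := slopeZ y 2 p q R.lo (i + 1) k (by omega) (by omega) (by omega)
    omega

theorem RepZ.low {n : ℤ} {E : ℕ → ℤ → Prop} {h : ℕ} {p q : ℤ} {y : ℤ → ℤ}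
    (R : RepZ n E h p q y) (j : ℤ) (b : j < y p) : ¬ E h j := by
  intro hE
  obtain ⟨k, k1, k2, rfl⟩ := R.ex j hE
  have := slopeZ y 2 p q R.lo p k (by omega) (by omega) (by omega)
  omega

theorem RepZ.upp {n : ℤ} {E : ℕ → ℤ → Prop} {h : ℕ} {p q : ℤ} {y : ℤ → ℤ}
    (R : RepZ n E h p q y) (j : ℤ) (b : y q < j) : ¬ E h j := by
  intro hE
  obtain ⟨k, k1, k2, rfl⟩ := R.ex j hE
  have := slopeZ y 2 p q R.lo k q (by omega) (by omega) (by omega)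
  omega

theorem upZ {n : ℤ} {M : ℕ} {E : ℕ → ℤ → Prop} (S : ESZ n M E) (hn : 4 ≤ n) {h : ℕ} {p q : ℤ}
    {y : ℤ → ℤ} (R : RepZ n E h p q y) (hM : h + 1 ≤ M) :
    ∃ p' q' x, RepZ n E (h + 1) p' q' x ∧
      ((y p = 2 ∧ p' = p ∧ y p < x p) ∨ (3 ≤ y p ∧ p' = p - 1 ∧ x (p - 1) < y p)) ∧
      ((y q = n - 1 ∧ q' = q - 1 ∧ x (q - 1) < y q) ∨ (y q ≤ n - 2 ∧ q' = q ∧ y q < x q)) := by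
  have dp := S.dom _ _ (R.mem p le_rfl R.le)
  have dq := S.dom _ _ (R.mem q R.le le_rfl)
  have hleft : ∃ xl, 3 ≤ y p → 2 ≤ xl ∧ xl < y p ∧ y p ≤ xl + 2 ∧ E (h + 1) xl ∧
      ∀ j, j < y p → E (h + 1) j → j = xl := by
    by_cases h3 : 3 ≤ y p
    · obtain ⟨x, hx⟩ := leftZ S hM (R.mem p le_rfl R.le) h3 R.lb R.low
      exact ⟨x, fun _ => hx⟩
    · exact ⟨0, fun h => absurd h h3⟩
  have hright : ∃ xr, y q ≤ n - 2 → xr ≤ n - 1 ∧ y q < xr ∧ xr ≤ y q + 2 ∧ E (h + 1) xr ∧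
      ∀ j, y q < j → E (h + 1) j → j = xr := by
    by_cases h3 : y q ≤ n - 2
    · obtain ⟨x, hx⟩ := rightZ S hM (R.mem q R.le le_rfl) h3 R.rb R.upp
      exact ⟨x, fun _ => hx⟩
    · exact ⟨0, fun h => absurd h h3⟩
  have hmid : ∀ i, ∃ x, p ≤ i → i < q → (x = y i + 1 ∨ x = y i + 2) ∧ x < y (i + 1) ∧
      y (i + 1) ≤ x + 2 ∧ E (h + 1) x ∧ ∀ j, y i < j → j < y (i + 1) → E (h + 1) j → j = x := by
    intro i
    by_cases hi : p ≤ i ∧ i < q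
    · obtain ⟨x, hx⟩ := midZ S hM (R.mem i hi.1 (by omega)) (R.mem (i + 1) (by omega) (by omega))
        (R.lo i hi.1 hi.2) (R.hi i hi.1 hi.2) (R.bet i hi.1 hi.2)
      exact ⟨x, fun _ _ => hx⟩
    · exact ⟨0, fun a b => absurd ⟨a, b⟩ hi⟩
  obtain ⟨xl, hl⟩ := hleft
  obtain ⟨xr, hr⟩ := hright
  choose xm hm using hmid
  have hpq := R.le
  have lb := R.lb
  have rb := R.rb
  obtain ⟨p', hp'⟩ : ∃ p', (y p = 2 ∧ p' = p) ∨ (3 ≤ y p ∧ p' = p - 1) := by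
    by_cases h3 : 3 ≤ y p
    · exact ⟨p - 1, by omega⟩
    · exact ⟨p, by omega⟩
  obtain ⟨q', hq'⟩ : ∃ q', (y q = n - 1 ∧ q' = q - 1) ∨ (y q ≤ n - 2 ∧ q' = q) := by
    by_cases h3 : y q ≤ n - 2
    · exact ⟨q, by omega⟩
    · exact ⟨q - 1, by omega⟩
  set x : ℤ → ℤ := fun i => if i < p then xl else if q ≤ i then xr else xm i with hx
  have xL : ∀ i, i < p → x i = xl := fun i hi => by simp [hx, hi]
  have xR : ∀ i, q ≤ i → x i = xr := fun i hi => by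
    have : ¬ i < p := by omega
    simp [hx, hi, this]
  have xM : ∀ i, p ≤ i → i < q → x i = xm i := fun i h1 h2 => by
    have a : ¬ i < p := by omega
    have b : ¬ q ≤ i := by omega
    simp [hx, a, b]
  have hpq' : p' ≤ q' := by
    by_cases hh : p = q
    · subst hh; omega
    · omega
  have bel : ∀ i, p ≤ i → i ≤ q' → y i + 1 ≤ x i ∧ x i ≤ y i + 2 := by
    intro i h1 h2
    by_cases h3 : i < q
    · rw [xM i h1 h3]
      have := hm i h1 h3
      omega
    · have e : i = q := by omega
      subst e
      rw [xR i le_rfl]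
      have := hr (by omega)
      omega
  have abo : ∀ i, p' ≤ i → i < q → x i + 1 ≤ y (i + 1) ∧ y (i + 1) ≤ x i + 2 := by
    intro i h1 h2
    by_cases h3 : p ≤ i
    · rw [xM i h3 h2]
      have := hm i h3 h2
      omega
    · have e : i = p - 1 := by omega
      subst e
      rw [xL _ (by omega)]
      have := hl (by omega)
      rw [show p - 1 + 1 = p by ring]
      omega
  refine ⟨p', q', x, ⟨hpq', ?_, ?_, ?_, ?_, ?_, ?_⟩, ?_, ?_⟩
  · intro i h1 h2
    by_cases h3 : i < p
    · rw [xL i h3]; exact (hl (by omega)).2.2.2.1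
    · by_cases h4 : q ≤ i
      · rw [xR i h4]; exact (hr (by omega)).2.2.2.1
      · rw [xM i (by omega) (by omega)]; exact (hm i (by omega) (by omega)).2.2.2.1
  · intro j hj
    have dj := S.dom _ _ hj
    by_cases h1 : j < y p
    · exact ⟨p - 1, by omega, by omega, by
        rw [xL _ (by omega)]; exact ((hl (by omega)).2.2.2.2 j h1 hj).symm⟩
    · by_cases h2 : y q < j
      · exact ⟨q, by omega, by omega, by
          rw [xR _ (by omega)]; exact ((hr (by omega)).2.2.2.2 j h2 hj).symm⟩
      · have hne : ∀ i, p ≤ i → i ≤ q → y i ≠ j := by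
          rintro i a b rfl
          exact S.sou _ _ (R.mem i a b) hj
        have := hne q (by omega) le_rfl
        obtain ⟨i, a, b, c, d⟩ := locZ y p q j hpq (by omega) (by omega)
        have := hne i a b.le
        exact ⟨i, by omega, by omega, by
          rw [xM _ a b]; exact ((hm i a b).2.2.2.2 j (by omega) d hj).symm⟩
  · intro i h1 h2
    have := abo i h1 (by omega)
    have := bel (i + 1) (by omega) (by omega)
    omega
  · intro i h1 h2
    have := abo i h1 (by omega)
    have := bel (i + 1) (by omega) (by omega)
    omega
  · rcases hp' with ⟨h1, h2⟩ | ⟨h1, h2⟩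
    · have := bel p' (by omega) (by omega)
      rw [h2] at this ⊢
      omega
    · rw [h2, xL _ (by omega)]
      have := hl h1
      omega
  · rcases hq' with ⟨h1, h2⟩ | ⟨h1, h2⟩
    · have := abo q' (by omega) (by omega)
      have e : q' + 1 = q := by omega
      rw [e] at this
      omega
    · have := bel q' (by omega) (by omega)
      rw [h2] at this ⊢
      omega
  · rcases hp' with ⟨h1, h2⟩ | ⟨h1, h2⟩
    · left
      have := bel p' (by omega) (by omega)
      rw [h2] at this
      exact ⟨h1, h2, by omega⟩
    · right
      refine ⟨h1, h2, ?_⟩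
      rw [xL _ (by omega)]
      exact (hl h1).2.1
  · rcases hq' with ⟨h1, h2⟩ | ⟨h1, h2⟩
    · left
      have := abo q' (by omega) (by omega)
      have e : q' + 1 = q := by omega
      rw [e, h2] at this
      exact ⟨h1, h2, by omega⟩
    · right
      have := bel q' (by omega) (by omega)
      rw [h2] at this
      exact ⟨h1, h2, by omega⟩

/-- The potential is nonpositive. -/
def PotZ (n : ℤ) (p q : ℤ) (y : ℤ → ℤ) : Prop :=
  n + 1 - (if y q = n - 1 then 2 else 3) - (if y p = 2 then 2 else 3) ≤ 3 * (q - p)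

theorem twoUpZ {n : ℤ} {M : ℕ} {E : ℕ → ℤ → Prop} (S : ESZ n M E) (hn : 4 ≤ n) {h : ℕ} {p q : ℤ}
    {y : ℤ → ℤ} (R : RepZ n E h p q y) (hP : PotZ n p q y) (hM : h + 2 ≤ M) :
    ∃ p' q' y', RepZ n E (h + 2) p' q' y' ∧ PotZ n p' q' y' := by
  obtain ⟨p1, q1, x, R1, l1, r1⟩ := upZ S hn R (by omega)
  obtain ⟨p2, q2, z, R2, l2, r2⟩ := upZ S hn R1 (by omega)
  refine ⟨p2, q2, z, R2, ?_⟩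
  unfold PotZ at *
  have a1 := S.dom _ _ (R.mem p le_rfl R.le)
  have a2 := S.dom _ _ (R.mem q R.le le_rfl)
  have b1 := S.dom _ _ (R1.mem p1 le_rfl R1.le)
  have b2 := S.dom _ _ (R1.mem q1 R1.le le_rfl)
  have c1 := S.dom _ _ (R2.mem p2 le_rfl R2.le)
  have c2 := S.dom _ _ (R2.mem q2 R2.le le_rfl)
  have := R.lb
  have := R.rb
  have := R1.lb
  have := R1.rb
  have := R2.lb
  have := R2.rb
  have key1 : (if z p2 = 2 then (2 : ℤ) else 3) - 3 * p2 ≥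
      (if y p = 2 then 2 else 3) - 3 * (p - 1) := by
    rcases l1 with ⟨u1, u2, u3⟩ | ⟨u1, u2, u3⟩ <;> rcases l2 with ⟨v1, v2, v3⟩ | ⟨v1, v2, v3⟩ <;>
      subst u2 <;> subst v2 <;> split_ifs <;> omega
  have key2 : (if z q2 = n - 1 then (2 : ℤ) else 3) + 3 * q2 ≥
      (if y q = n - 1 then 2 else 3) + 3 * (q - 1) := by
    rcases r1 with ⟨u1, u2, u3⟩ | ⟨u1, u2, u3⟩ <;> rcases r2 with ⟨v1, v2, v3⟩ | ⟨v1, v2, v3⟩ <;>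
      subst u2 <;> subst v2 <;> split_ifs <;> omega
  linarith

theorem gapTwoZ {n : ℤ} {M : ℕ} {E : ℕ → ℤ → Prop} (S : ESZ n M E) {h : ℕ} {a : ℤ}
    (hM : h + 1 ≤ M) (Ea : E h a) (Eb : E h (a + 2)) :
    h + 2 ≤ M ∧ E (h + 2) (a - 1) ∧ E (h + 2) (a + 3) := by
  have da := S.dom _ _ Ea
  have db := S.dom _ _ Eb
  have na := S.sou _ _ Ea
  have nb := S.sou _ _ Eb
  have nm := S.adj _ _ Ea
  have hc : E (h + 1) (a + 1) := by
    by_contra hc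
    have := S.sun h (a + 1) hM (by omega) (by omega) hc
    rw [show a + 1 - 1 = a by ring, show a + 1 + 1 = a + 2 by ring] at this
    tauto
  have nc := S.sou _ _ hc
  have al := S.alt _ _ hc
  rw [show a + 1 - 2 = a - 1 by ring, show a + 1 - 1 = a by ring,
        show a + 1 + 2 = a + 3 by ring, show a + 1 + 1 = a + 2 by ring] at al
  have al : h + 2 ≤ M ∧ ¬ E (h + 2) a ∧ ¬ E (h + 2) (a + 2) := by tauto
  have s1 := S.sun (h + 1) a al.1 (by omega) (by omega) al.2.1
  have s2 := S.sun (h + 1) (a + 2) al.1 (by omega) (by omega) al.2.2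
  rw [show a + 2 - 1 = a + 1 by ring, show a + 2 + 1 = a + 3 by ring] at s2
  exact ⟨al.1, by tauto, by tauto⟩

theorem gapLZ {n : ℤ} {M : ℕ} {E : ℕ → ℤ → Prop} (S : ESZ n M E) {h : ℕ}
    (hM : h + 1 ≤ M) (Ea : E h 3) (h2 : ¬ E h 2) :
    h + 2 ≤ M ∧ ¬ E (h + 2) 2 ∧ ¬ E (h + 2) 3 := by
  have da := S.dom _ _ Ea
  have na := S.sou _ _ Ea
  have n1 : ¬ E (h + 1) 1 := fun hc => by have := S.dom _ _ hc; omega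
  have hc : E (h + 1) 2 := by
    by_contra hc
    have := S.sun h 2 hM (by omega) (by omega) hc
    norm_num at this
    tauto
  have nc := S.sou _ _ hc
  have al := S.alt _ _ hc
  norm_num at al
  exact ⟨by tauto, nc, by tauto⟩

theorem gapRZ {n : ℤ} {M : ℕ} {E : ℕ → ℤ → Prop} (S : ESZ n M E) {h : ℕ}
    (hM : h + 1 ≤ M) (Ea : E h (n - 2)) (h2 : ¬ E h (n - 1)) :
    h + 2 ≤ M ∧ ¬ E (h + 2) (n - 1) ∧ ¬ E (h + 2) (n - 2) := by
  have := gapLZ S.refl (h := h) hM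
  simp only [show n + 1 - 3 = n - 2 by ring, show n + 1 - 2 = n - 1 by ring] at this
  exact this Ea h2

theorem parZ {n : ℤ} {M : ℕ} {E : ℕ → ℤ → Prop} (S : ESZ n M E) (hn : 4 ≤ n) {h : ℕ} {p q : ℤ}
    {y : ℤ → ℤ} (R : RepZ n E h p q y) (hP : PotZ n p q y) (hM : h + 2 = M) : False := by
  obtain ⟨p1, q1, x, R1, l1, r1⟩ := upZ S hn R (by omega)
  have h3 : ∀ i, p1 ≤ i → i < q1 → x i + 3 ≤ x (i + 1) := by
    intro i h1 h2
    by_contra hc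
    have e := R1.lo i h1 h2
    have e : x (i + 1) = x i + 2 := by omega
    have Ea := R1.mem i h1 h2.le
    have Eb := R1.mem (i + 1) (by omega) (by omega)
    rw [e] at Eb
    have := gapTwoZ S (by omega) Ea Eb
    omega
  have hL : x p1 ≠ 3 := by
    intro hc
    have := gapLZ S (h := h + 1) (by omega) (hc ▸ R1.mem p1 le_rfl R1.le) (R1.low 2 (by omega))
    omega
  have hR : x q1 ≠ n - 2 := by
    intro hc
    have := gapRZ S (h := h + 1) (by omega) (hc ▸ R1.mem q1 R1.le le_rfl)
      (R1.upp (n - 1) (by omega))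
    omega
  have sl := slopeZ x 3 p1 q1 h3 p1 q1 R1.le le_rfl le_rfl
  unfold PotZ at hP
  have a1 := S.dom _ _ (R.mem p le_rfl R.le)
  have a2 := S.dom _ _ (R.mem q R.le le_rfl)
  have b1 := S.dom _ _ (R1.mem p1 le_rfl R1.le)
  have b2 := S.dom _ _ (R1.mem q1 R1.le le_rfl)
  have := R.lb
  have := R.rb
  have := R1.lb
  have := R1.rb
  have key1 : x p1 - 3 * p1 ≥ (if y p = 2 then 2 else 3) - 3 * p + 2 := by
    rcases l1 with ⟨u1, u2, u3⟩ | ⟨u1, u2, u3⟩ <;> subst u2 <;> split_ifs <;> omega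
  have key2 : n + 1 - x q1 + 3 * q1 ≥ (if y q = n - 1 then 2 else 3) + 3 * q - 1 := by
    rcases r1 with ⟨u1, u2, u3⟩ | ⟨u1, u2, u3⟩ <;> subst u2 <;> split_ifs <;> omega
  linarith

theorem potD {n : ℤ} {M : ℕ} {E : ℕ → ℤ → Prop} (S : ESZ n M E) {h : ℕ} {p q : ℤ}
    {y : ℤ → ℤ} (R : RepZ n E h p q y) (hP : PotZ n p q y) : y q - y p ≤ 3 * (q - p) := by
  unfold PotZ at hP
  have a1 := S.dom _ _ (R.mem p le_rfl R.le)
  have a2 := S.dom _ _ (R.mem q R.le le_rfl)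
  split_ifs at hP <;> omega

theorem noTwoZ {n : ℤ} {M : ℕ} {E : ℕ → ℤ → Prop} (S : ESZ n M E) (hn : 4 ≤ n) :
    ∀ (d h : ℕ) (p q : ℤ) (y : ℤ → ℤ), M = h + 1 + 2 * d → RepZ n E h p q y → PotZ n p q y →
    ∀ i, p ≤ i → i < q → y i + 3 ≤ y (i + 1) := by
  intro d
  induction d with
  | zero =>
    intro h p q y hd R hP i h1 h2
    by_contra hc
    have e := R.lo i h1 h2
    have e : y (i + 1) = y i + 2 := by omega
    have Ea := R.mem i h1 h2.le
    have Eb := R.mem (i + 1) (by omega) (by omega)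
    rw [e] at Eb
    have := gapTwoZ S (by omega) Ea Eb
    omega
  | succ d ih =>
    intro h p q y hd R hP i h1 h2
    by_contra hc
    have e := R.lo i h1 h2
    have e : y (i + 1) = y i + 2 := by omega
    have Ea := R.mem i h1 h2.le
    have Eb := R.mem (i + 1) (by omega) (by omega)
    rw [e] at Eb
    obtain ⟨-, k1, k2⟩ := gapTwoZ S (by omega) Ea Eb
    obtain ⟨p', q', z, R', P'⟩ := twoUpZ S hn R hP (by omega)
    have H := ih (h + 2) p' q' z (by omega) R' P'
    have D := potD S R' P'
    obtain ⟨a, a1, a2, a3⟩ := R'.ex _ k1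
    obtain ⟨b, b1, b2, b3⟩ := R'.ex _ k2
    have hab : a ≤ b := by
      by_contra hh
      have := slopeZ z 3 p' q' H b a (by omega) b1 a2
      omega
    have t1 := slopeZ z 3 p' q' H a b hab a1 b2
    have t2 := slopeZ z 3 p' q' H p' a a1 le_rfl a2
    have t3 := slopeZ z 3 p' q' H b q' b2 b1 le_rfl
    omega

def LegZ (n : ℤ) (E : ℕ → ℤ → Prop) (h : ℕ) : Prop :=
  ∀ j, E h j ↔ 2 ≤ j ∧ j ≤ n - 1 ∧ j % 3 = 2

theorem potLeg {n : ℤ} {M : ℕ} {E : ℕ → ℤ → Prop} (S : ESZ n M E) (hn : 4 ≤ n) {h : ℕ} {p q : ℤ}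
    {y : ℤ → ℤ} (R : RepZ n E h p q y) (hP : PotZ n p q y) {d : ℕ} (hd : M = h + 1 + 2 * d) :
    n % 3 = 0 ∧ LegZ n E h := by
  have H := noTwoZ S hn d h p q y hd R hP
  have D := potD S R hP
  have sl := slopeZ y 3 p q H p q R.le le_rfl le_rfl
  have a1 := S.dom _ _ (R.mem p le_rfl R.le)
  have a2 := S.dom _ _ (R.mem q R.le le_rfl)
  have := R.lb
  have := R.rb
  -- auxiliary: rows with the potential bound do not start with 4 or end with n-3
  have aux : ∀ (e h' : ℕ) (p' q' : ℤ) (z : ℤ → ℤ), M = h' + 1 + 2 * e → RepZ n E h' p' q' z →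
      PotZ n p' q' z → z p' ≤ 3 ∧ n - 2 ≤ z q' := by
    intro e h' p' q' z he R' P'
    have H' := noTwoZ S hn e h' p' q' z he R' P'
    have sl' := slopeZ z 3 p' q' H' p' q' R'.le le_rfl le_rfl
    have b1 := S.dom _ _ (R'.mem p' le_rfl R'.le)
    have b2 := S.dom _ _ (R'.mem q' R'.le le_rfl)
    unfold PotZ at P'
    split_ifs at P' <;> omega
  have hh := aux d h p q y hd R hP
  have hp : y p ≠ 3 := by
    intro hc
    obtain ⟨k1, k2, k3⟩ := gapLZ S (h := h) (by omega) (hc ▸ R.mem p le_rfl R.le)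
      (R.low 2 (by omega))
    obtain ⟨p', q', z, R', P'⟩ := twoUpZ S hn R hP (by omega)
    have t := aux (d - 1) (h + 2) p' q' z (by omega) R' P'
    have mm := R'.mem p' le_rfl R'.le
    have b1 := S.dom _ _ mm
    have : z p' = 2 ∨ z p' = 3 := by omega
    rcases this with e | e <;> rw [e] at mm <;> tauto
  have hq : y q ≠ n - 2 := by
    intro hc
    obtain ⟨k1, k2, k3⟩ := gapRZ S (h := h) (by omega) (hc ▸ R.mem q R.le le_rfl)
      (R.upp (n - 1) (by omega))
    obtain ⟨p', q', z, R', P'⟩ := twoUpZ S hn R hP (by omega)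
    have t := aux (d - 1) (h + 2) p' q' z (by omega) R' P'
    have mm := R'.mem q' R'.le le_rfl
    have b1 := S.dom _ _ mm
    have : z q' = n - 1 ∨ z q' = n - 2 := by omega
    rcases this with e | e <;> rw [e] at mm <;> tauto
  have hv : ∀ i, p ≤ i → i ≤ q → y i = 2 + 3 * (i - p) := by
    intro i h1 h2
    have t1 := slopeZ y 3 p q H p i h1 le_rfl h2
    have t2 := slopeZ y 3 p q H i q h2 h1 le_rfl
    omega
  have hvq := hv q R.le le_rfl
  refine ⟨by omega, fun j => ⟨fun hj => ?_, fun hj => ?_⟩⟩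
  · have dj := S.dom _ _ hj
    obtain ⟨i, i1, i2, i3⟩ := R.ex j hj
    have := hv i i1 i2
    exact ⟨by omega, by omega, by omega⟩
  · have := hv (p + (j - 2) / 3) (by omega) (by omega)
    have e : y (p + (j - 2) / 3) = j := by omega
    rw [← e]
    exact R.mem _ (by omega) (by omega)

theorem baseZ {n : ℤ} {M : ℕ} {E : ℕ → ℤ → Prop} (S : ESZ n M E) (hn : 4 ≤ n) (hM : 1 ≤ M) :
    ∃ p q y, RepZ n E 1 p q y ∧ PotZ n p q y := by
  classical
  have E0 : ∀ j, ¬ E 0 j := fun j hj => by have := S.dom _ _ hj; omega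
  have sn : ∀ j, 2 ≤ j → j ≤ n - 1 → ¬ E 1 j → E 1 (j - 1) ∨ E 1 (j + 1) := by
    intro j h1 h2 h3
    have := S.sun 0 j (by omega) h1 h2 h3
    have := E0 j
    tauto
  have n1 : ¬ E 1 1 := fun hc => by have := S.dom _ _ hc; omega
  have nn : ¬ E 1 n := fun hc => by have := S.dom _ _ hc; omega
  set f : ℕ → ℤ := fun k => Nat.rec (if E 1 2 then 2 else 3)
    (fun _ a => if E 1 (a + 2) then a + 2 else a + 3) k with hf
  have f0 : f 0 = if E 1 2 then 2 else 3 := rfl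
  have fs : ∀ k, f (k + 1) = if E 1 (f k + 2) then f k + 2 else f k + 3 := fun k => rfl
  have g : ∀ k, f k + 2 ≤ f (k + 1) ∧ f (k + 1) ≤ f k + 3 := by
    intro k
    rw [fs]
    split_ifs <;> omega
  have e0 : E 1 (f 0) := by
    rw [f0]
    split_ifs with h2
    · exact h2
    · have := sn 2 (by omega) (by omega) h2
      norm_num at this
      tauto
  have e0' : f 0 = 2 ∨ f 0 = 3 ∧ ¬ E 1 2 := by
    rw [f0]; split_ifs with h2 <;> simp [h2]
  have gr : ∀ k : ℕ, (k : ℤ) ≤ f k := by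
    intro k
    induction k with
    | zero => push_cast; omega
    | succ k ih => have := g k; push_cast; omega
  have hex : ∃ k, n - 2 ≤ f k := ⟨n.toNat, by have := gr n.toNat; omega⟩
  set Q := Nat.find hex with hQ
  have hQ1 : n - 2 ≤ f Q := Nat.find_spec hex
  have hQ2 : ∀ k, k < Q → f k < n - 2 := fun k hk => by
    have := Nat.find_min hex hk
    omega
  have mem : ∀ k, k ≤ Q → E 1 (f k) := by
    intro k
    induction k with
    | zero => intro _; exact e0
    | succ k ih =>
      intro hk
      have ek := ih (by omega)
      have := hQ2 k (by omega)
      have dk := S.dom _ _ ek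
      have nk := S.adj _ _ ek
      rw [fs]
      split_ifs with h2
      · exact h2
      · have := sn (f k + 2) (by omega) (by omega) h2
        rw [show f k + 2 - 1 = f k + 1 by ring, show f k + 2 + 1 = f k + 3 by ring] at this
        tauto
  have hlo : ∀ i : ℤ, 0 ≤ i → i < Q → f i.toNat + 2 ≤ f (i + 1).toNat := by
    intro i h1 h2
    have := g i.toNat
    rw [show (i + 1).toNat = i.toNat + 1 by omega]
    omega
  have hhi : ∀ i : ℤ, 0 ≤ i → i < Q → f (i + 1).toNat ≤ f i.toNat + 3 := by
    intro i h1 h2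
    have := g i.toNat
    rw [show (i + 1).toNat = i.toNat + 1 by omega]
    omega
  have dQ := S.dom _ _ (mem Q le_rfl)
  refine ⟨0, Q, fun i => f i.toNat, ⟨by omega, ?_, ?_, ?_, ?_, ?_, ?_⟩, ?_⟩
  · intro i h1 h2
    exact mem _ (by omega)
  · intro j hj
    have dj := S.dom _ _ hj
    by_cases c1 : j < f 0
    · exfalso
      have : j = 2 := by omega
      subst this
      rcases e0' with e | ⟨e, e'⟩
      · omega
      · exact e' hj
    · by_cases c2 : f Q ≤ j
      · refine ⟨Q, by omega, le_rfl, ?_⟩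
        simp only [Int.toNat_natCast]
        by_contra hne
        have : j = f Q + 1 := by omega
        exact S.adj _ _ (mem Q le_rfl) (this ▸ hj)
      · obtain ⟨i, i1, i2, i3, i4⟩ := locZ (fun i => f i.toNat) 0 Q j (by omega)
          (by simpa using c1) (by simpa using c2)
        have u := g i.toNat
        have v := fs i.toNat
        rw [show (i + 1).toNat = i.toNat + 1 by omega] at i4
        refine ⟨i, i1, i2.le, ?_⟩
        by_contra hne
        have w := S.adj _ _ (mem i.toNat (by omega))
        have : j = f i.toNat + 1 ∨ j = f i.toNat + 2 := by omega
        rcases this with e | e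
        · exact w (e ▸ hj)
        · rw [e] at hj
          rw [if_pos hj] at v
          omega
  · intro i h1 h2; exact hlo i h1 h2
  · intro i h1 h2; have := hhi i h1 h2; omega
  · simp only [Int.toNat_zero]; omega
  · simp only [Int.toNat_natCast]; omega
  · have t := slopeZ' (fun i => f i.toNat) 3 0 Q hhi 0 Q (by omega) le_rfl le_rfl
    unfold PotZ
    simp only [Int.toNat_zero, Int.toNat_natCast] at t ⊢
    split_ifs <;> omega

theorem mainZ {n : ℤ} {M : ℕ} {E : ℕ → ℤ → Prop} (S : ESZ n M E) (hn : 3 ≤ n) (hM : 2 ≤ M) :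
    n % 3 = 0 ∧ M % 2 = 0 ∧ ∀ k, 2 * k + 1 ≤ M → LegZ n E (2 * k + 1) := by
  by_cases h3 : n = 3
  · subst h3
    have col : ∀ h j, E h j → j = 2 := fun h j hj => by have := S.dom _ _ hj; omega
    have st : ∀ h, h + 1 ≤ M → (E (h + 1) 2 ↔ ¬ E h 2) := by
      intro h hh
      refine ⟨fun a b => S.sou _ _ b a, fun a => ?_⟩
      by_contra hc
      rcases S.sun h 2 hh (by omega) (by omega) hc with t | t | t
      · have := col _ _ t; omega
      · have := col _ _ t; omega
      · exact a t
    have E0 : ∀ j, ¬ E 0 j := fun j hj => by have := S.dom _ _ hj; omega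
    have all : ∀ k, 2 * k + 1 ≤ M → E (2 * k + 1) 2 := by
      intro k
      induction k with
      | zero => intro hk; exact (st 0 (by omega)).2 (E0 2)
      | succ k ih =>
        intro hk
        have := ih (by omega)
        refine (st (2 * k + 2) (by omega)).2 ?_
        rw [st (2 * k + 1) (by omega)]
        tauto
    refine ⟨by norm_num, ?_, ?_⟩
    · by_contra hc
      have := all (M / 2) (by omega)
      rcases S.alt _ _ this with t | t | t <;> omega
    · intro k hk j
      constructor
      · intro hj
        have := col _ _ hj
        omega
      · intro hj
        have : j = 2 := by omega
        rw [this]; exact all k hk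
  · have hn4 : 4 ≤ n := by omega
    have chain : ∀ k, 2 * k + 1 ≤ M → ∃ p q y, RepZ n E (2 * k + 1) p q y ∧ PotZ n p q y := by
      intro k
      induction k with
      | zero => intro hk; exact baseZ S hn4 (by omega)
      | succ k ih =>
        intro hk
        obtain ⟨p, q, y, R, P⟩ := ih (by omega)
        exact twoUpZ S hn4 R P (by omega)
    have hev : M % 2 = 0 := by
      by_contra hc
      obtain ⟨p, q, y, R, P⟩ := chain (M / 2 - 1) (by omega)
      exact parZ S hn4 R P (by omega)
    have leg : ∀ k, 2 * k + 1 ≤ M → n % 3 = 0 ∧ LegZ n E (2 * k + 1) := by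
      intro k hk
      obtain ⟨p, q, y, R, P⟩ := chain k hk
      exact potLeg S hn4 R P (d := (M - (2 * k + 1) - 1) / 2) (by omega)
    exact ⟨(leg 0 (by omega)).1, hev, fun k hk => (leg k hk).2⟩
theorem emptyZ {m n : ℕ} {C : ℕ → ℕ → Bool} (hp : ResistPred2 m n C) {i j : ℕ}
    (h1 : 1 ≤ i) (h2 : i ≤ m) (h3 : 1 ≤ j) (h4 : j ≤ n) (h : C i j = false) :
    i < m ∧ 2 ≤ j ∧ j < n ∧ C i (j - 1) = true ∧ C i (j + 1) = true ∧ C (i + 1) j = true := by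
  have := hp i j h1 h2 h3 h4 h
  have e : j - 1 ≠ j := by omega
  simp only [Sun2, occupy2, e, and_false, if_false, not_or, Bool.not_eq_false, Nat.succ_ne_self,
    and_true] at this
  obtain ⟨⟨a, b⟩, ⟨c, d⟩, e, f⟩ := this
  exact ⟨by omega, by omega, by omega, b, d, f⟩

theorem toES {m n : ℕ} (hm : 2 < m) {C : ℕ → ℕ → Bool}
    (hper : Permissible2 m n C) (hp : ResistPred2 m n C) (ha : ResistAlt2 m n C) :
    ESZ (n : ℤ) (m - 1)
      (fun h j => 1 ≤ j ∧ j ≤ (n : ℤ) ∧ h ≤ m - 1 ∧ C (m - h) j.toNat = false) where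
  dom := by
    rintro h j ⟨h1, h2, h3, h4⟩
    have := emptyZ hp (by omega) (by omega) (by omega) (by omega) h4
    omega
  adj := by
    rintro h j ⟨h1, h2, h3, h4⟩ ⟨g1, g2, g3, g4⟩
    have := emptyZ hp (by omega) (by omega) (by omega) (by omega) h4
    rw [show (j + 1).toNat = j.toNat + 1 by omega, this.2.2.2.2.1] at g4
    simp at g4
  sou := by
    rintro h j ⟨h1, h2, h3, h4⟩ ⟨g1, g2, g3, g4⟩
    have := emptyZ hp (by omega) (by omega) (by omega) (by omega) g4
    rw [show m - (h + 1) + 1 = m - h by omega, h4] at this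
    simp at this
  sun := by
    intro h j h1 h2 h3 h4
    have ht : C (m - (h + 1)) j.toNat = true := by
      by_contra hc
      exact h4 ⟨by omega, by omega, h1, by simpa using hc⟩
    have := hper (m - (h + 1)) j.toNat (by omega) (by omega) (by omega) (by omega) ht
    unfold Sun2 at this
    rw [show m - (h + 1) + 1 = m - h by omega] at this
    rw [show (j + 1).toNat = j.toNat + 1 by omega, show (j - 1).toNat = j.toNat - 1 by omega]
    rcases this with (t | t) | (t | t) | (t | t)
    · omega
    · left; exact ⟨by omega, by omega, by omega, t⟩
    · omega
    · right; left; exact ⟨by omega, by omega, by omega, t⟩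
    · omega
    · right; right; exact ⟨by omega, by omega, by omega, t⟩
  alt := by
    rintro h j ⟨h1, h2, h3, h4⟩
    have em := emptyZ hp (by omega) (by omega) (by omega) (by omega) h4
    obtain ⟨a, b, a1, a2, b1, b2, hne, hC, hs⟩ :=
      ha (m - (h + 1)) j.toNat (by omega) (by omega) (by omega) (by omega) h4
    have hold := hper a b a1 a2 b1 b2 hC
    simp only [Sun2, occupy2, not_or] at hs
    obtain ⟨⟨w1, w2⟩, ⟨e1, e2⟩, s1, s2⟩ := hs
    have key : ∀ c d, (if c = m - (h + 1) ∧ d = j.toNat then true else C c d) ≠ false →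
        (c = m - (h + 1) ∧ d = j.toNat) ∨ C c d = true := by
      intro c d hcd
      split_ifs at hcd with hh
      · left; exact hh
      · right; simpa using hcd
    have kw := key _ _ w2
    have ke := key _ _ e2
    have ks := key _ _ s2
    unfold Sun2 at hold
    have which : (a = m - (h + 1) ∧ b - 1 = j.toNat) ∨ (a = m - (h + 1) ∧ b + 1 = j.toNat) ∨
        (a + 1 = m - (h + 1) ∧ b = j.toNat) := by
      rcases hold with (t | t) | (t | t) | (t | t)
      · omega
      · rw [t] at kw; left; simpa using kw
      · omega
      · rw [t] at ke; right; left; simpa using ke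
      · omega
      · rw [t] at ks; right; right; simpa using ks
    rcases which with ⟨t1, t2⟩ | ⟨t1, t2⟩ | ⟨t1, t2⟩
    · right; left
      refine ⟨by omega, ?_, ?_⟩
      · rintro ⟨g1, g2, g3, g4⟩
        rw [show (j + 2).toNat = b + 1 by omega, ← t1] at g4
        rw [g4] at ke
        have : b + 1 = j.toNat := by simpa using (ke.resolve_right (by simp)).2
        omega
      · rintro ⟨g1, g2, g3, g4⟩
        rw [show (j + 1).toNat = b by omega, show m - h = a + 1 by omega] at g4
        rw [g4] at ks
        have := (ks.resolve_right (by simp)).1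
        omega
    · left
      refine ⟨by omega, ?_, ?_⟩
      · rintro ⟨g1, g2, g3, g4⟩
        rw [show (j - 2).toNat = b - 1 by omega, ← t1] at g4
        rw [g4] at kw
        have := (kw.resolve_right (by simp)).2
        omega
      · rintro ⟨g1, g2, g3, g4⟩
        rw [show (j - 1).toNat = b by omega, show m - h = a + 1 by omega] at g4
        rw [g4] at ks
        have := (ks.resolve_right (by simp)).1
        omega
    · right; right
      refine ⟨by omega, ?_, ?_⟩
      · rintro ⟨g1, g2, g3, g4⟩
        rw [show (j - 1).toNat = b - 1 by omega, show m - (h + 2) = a by omega] at g4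
        rw [g4] at kw
        have := (kw.resolve_right (by simp)).1
        omega
      · rintro ⟨g1, g2, g3, g4⟩
        rw [show (j + 1).toNat = b + 1 by omega, show m - (h + 2) = a by omega] at g4
        rw [g4] at ke
        have := (ke.resolve_right (by simp)).1
        omega

theorem rowOcc_succ (n : ℕ) (C : ℕ → ℕ → Bool) (i : ℕ) :
    rowOcc (n + 1) C i = rowOcc n C i + (C i (n + 1)).toNat := by
  unfold rowOcc
  rw [Finset.card_filter, Finset.card_filter, Finset.sum_Icc_succ_top (by omega)]
  cases C i (n + 1) <;> simp

theorem rowOcc_full (n : ℕ) (C : ℕ → ℕ → Bool) (i : ℕ) (H : ∀ j, 1 ≤ j → j ≤ n → C i j = true) :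
    rowOcc n C i = n := by
  induction n with
  | zero => simp [rowOcc]
  | succ n ih =>
    rw [rowOcc_succ, ih (fun j a b => H j a (by omega)), H (n + 1) (by omega) le_rfl]
    simp

theorem rowOcc_leg (L : ℕ) (C : ℕ → ℕ → Bool) (i : ℕ)
    (H : ∀ j, 1 ≤ j → j ≤ 3 * L → (C i j = false ↔ j % 3 = 2)) :
    rowOcc (3 * L) C i = 2 * L := by
  induction L with
  | zero => simp [rowOcc]
  | succ L ih =>
    rw [show 3 * (L + 1) = 3 * L + 1 + 1 + 1 by ring, rowOcc_succ, rowOcc_succ, rowOcc_succ,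
      ih (fun j a b => H j a (by omega))]
    have h1 := H (3 * L + 1) (by omega) (by omega)
    have h2 := H (3 * L + 1 + 1) (by omega) (by omega)
    have h3 := H (3 * L + 1 + 1 + 1) (by omega) (by omega)
    have h1 : C i (3 * L + 1) = true := by
      rw [← Bool.not_eq_false, h1]; omega
    have h2 : C i (3 * L + 1 + 1) = false := by
      rw [h2]; omega
    have h3 : C i (3 * L + 1 + 1 + 1) = true := by
      rw [← Bool.not_eq_false, h3]; omega
    rw [h1, h2, h3]
    simp; ring

theorem rowOcc_pair (L : ℕ) (C : ℕ → ℕ → Bool) (i : ℕ) (h1 : C i 1 = true)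
    (H2 : ∀ j, 1 ≤ j → j ≤ 3 * L + 2 → j % 3 = 2 → C i j = true)
    (H : ∀ l, 1 ≤ l → l ≤ L →
        (C i (3 * l) = true ∧ C i (3 * l + 1) = false) ∨
        (C i (3 * l) = false ∧ C i (3 * l + 1) = true)) :
    rowOcc (3 * L + 2) C i = 2 * L + 2 := by
  induction L with
  | zero =>
    have := H2 2 (by omega) (by omega) (by omega)
    have e : rowOcc 0 C i = 0 := by simp [rowOcc]
    rw [show 3 * 0 + 2 = 0 + 1 + 1 by rfl, rowOcc_succ, rowOcc_succ, e]
    simp [h1, this]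
  | succ L ih =>
    have ih := ih (fun j a b => H2 j a (by omega)) (fun l a b => H l a (by omega))
    have t := H (L + 1) (by omega) le_rfl
    have u := H2 (3 * (L + 1) + 2) (by omega) (by omega) (by omega)
    have e : rowOcc (3 * (L + 1)) C i = rowOcc (3 * L + 2) C i + (C i (3 * (L + 1))).toNat :=
      rowOcc_succ (3 * L + 2) C i
    rw [show 3 * (L + 1) + 2 = 3 * (L + 1) + 1 + 1 by ring] at u ⊢
    rw [rowOcc_succ, rowOcc_succ, e, ih, u]
    rcases t with ⟨a, b⟩ | ⟨a, b⟩ <;> rw [a, b] <;> simp <;> ring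

theorem total_aux (f : ℕ → ℕ) (A B : ℕ) (K : ℕ)
    (hA : ∀ k, k < K → f (2 * k + 2) = A) (hB : ∀ k, k < K → f (2 * k + 1) = B) :
    ∑ i ∈ Finset.Icc 1 (2 * K), f i = K * (A + B) := by
  induction K with
  | zero => simp
  | succ K ih =>
    rw [show 2 * (K + 1) = 2 * K + 1 + 1 by ring, Finset.sum_Icc_succ_top (by omega),
      Finset.sum_Icc_succ_top (by omega), ih (fun k hk => hA k (by omega))
      (fun k hk => hB k (by omega)), hB K (by omega), hA K (by omega)]
    ring

theorem stmt19 (m n : ℕ) (hm : 2 < m) (hn : 2 < n) (C : ℕ → ℕ → Bool)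
    (hmax : IsMaximal2 m n C) (hp : ResistPred2 m n C) (ha : ResistAlt2 m n C) :
    3 ∣ n ∧ Odd m ∧
    ((totalOcc m n C : ℚ) = (m : ℚ) * n - ((m : ℚ) - 1) * (2 * n - 3) / 6) ∧
    ((totalOcc m n C : ℚ) = 2 / 3 * ((m : ℚ) * n) + ((m : ℚ) - 1) / 2 + (n : ℚ) / 3) ∧
    (∀ k : ℕ, 1 ≤ m - 1 - 2 * k →
      ∀ j, 1 ≤ j → j ≤ n → (C (m - 1 - 2 * k) j = false ↔ j % 3 = 2)) ∧
    (∀ j, 1 ≤ j → j ≤ n → C m j = true) ∧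
    (∀ k : ℕ, 1 ≤ k → 1 ≤ m - 2 * k →
      C (m - 2 * k) 1 = true ∧ C (m - 2 * k) n = true ∧
      (∀ j, 1 ≤ j → j ≤ n → j % 3 = 2 → C (m - 2 * k) j = true) ∧
      (∀ l, 1 ≤ l → l ≤ (n - 3) / 3 →
        (C (m - 2 * k) (3 * l) = true ∧ C (m - 2 * k) (3 * l + 1) = false) ∨
        (C (m - 2 * k) (3 * l) = false ∧ C (m - 2 * k) (3 * l + 1) = true))) := by
  have S := toES hm hmax.1 hp ha
  obtain ⟨hn3, hM2, leg⟩ := mainZ S (by omega) (by omega)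
  obtain ⟨K, rfl⟩ : ∃ K, m = 2 * K + 1 := ⟨m / 2, by omega⟩
  obtain ⟨L, rfl⟩ : ∃ L, n = 3 * (L + 1) := ⟨n / 3 - 1, by omega⟩
  have hleg : ∀ k : ℕ, 1 ≤ 2 * K + 1 - 1 - 2 * k → ∀ j, 1 ≤ j → j ≤ 3 * (L + 1) →
      (C (2 * K + 1 - 1 - 2 * k) j = false ↔ j % 3 = 2) := by
    intro k hk j j1 j2
    have := leg k (by omega) (j : ℤ)
    simp only [Int.toNat_natCast] at this
    rw [show 2 * K + 1 - (2 * k + 1) = 2 * K + 1 - 1 - 2 * k by omega] at this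
    constructor
    · intro h
      have := this.1 ⟨by omega, by omega, by omega, h⟩
      omega
    · intro h
      exact (this.2 ⟨by omega, by omega, by omega⟩).2.2.2
  have hbot : ∀ j, 1 ≤ j → j ≤ 3 * (L + 1) → C (2 * K + 1) j = true := by
    intro j h1 h2
    by_contra hc
    have := emptyZ hp (by omega) le_rfl h1 h2 (by simpa using hc)
    omega
  have hpair : ∀ k : ℕ, 1 ≤ k → 1 ≤ 2 * K + 1 - 2 * k →
      C (2 * K + 1 - 2 * k) 1 = true ∧ C (2 * K + 1 - 2 * k) (3 * (L + 1)) = true ∧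
      (∀ j, 1 ≤ j → j ≤ 3 * (L + 1) → j % 3 = 2 → C (2 * K + 1 - 2 * k) j = true) ∧
      (∀ l, 1 ≤ l → l ≤ (3 * (L + 1) - 3) / 3 →
        (C (2 * K + 1 - 2 * k) (3 * l) = true ∧ C (2 * K + 1 - 2 * k) (3 * l + 1) = false) ∨
        (C (2 * K + 1 - 2 * k) (3 * l) = false ∧ C (2 * K + 1 - 2 * k) (3 * l + 1) = true)) := by
    intro k k1 k2
    have lg := hleg (k - 1) (by omega)
    rw [show 2 * K + 1 - 1 - 2 * (k - 1) = 2 * K + 1 - 2 * k + 1 by omega] at lg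
    set i := 2 * K + 1 - 2 * k with hi
    have em : ∀ j, 1 ≤ j → j ≤ 3 * (L + 1) → C i j = false → _ := fun j h1 h2 h3 =>
      emptyZ hp k2 (show i ≤ 2 * K + 1 by omega) h1 h2 h3
    have h2 : ∀ j, 1 ≤ j → j ≤ 3 * (L + 1) → j % 3 = 2 → C i j = true := by
      intro j j1 j2 j3
      by_contra hc
      have := em j j1 j2 (by simpa using hc)
      rw [(lg j j1 j2).2 j3] at this
      simp at this
    refine ⟨?_, ?_, h2, ?_⟩
    · by_contra hc
      have := em 1 le_rfl (by omega) (by simpa using hc)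
      omega
    · by_contra hc
      have := em (3 * (L + 1)) (by omega) le_rfl (by simpa using hc)
      omega
    · intro l l1 l2
      cases ea : C i (3 * l) with
      | false =>
        right
        exact ⟨rfl, (em (3 * l) (by omega) (by omega) ea).2.2.2.2.1⟩
      | true =>
        left
        refine ⟨rfl, ?_⟩
        by_contra hc
        have sn := hmax.1 i (3 * l) k2 (by omega) (by omega) (by omega) ea
        have w := h2 (3 * l - 1) (by omega) (by omega) (by omega)
        have s := lg (3 * l) (by omega) (by omega)
        unfold Sun2 at sn
        rcases sn with (t | t) | (t | t) | (t | t)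
        · omega
        · rw [w] at t; simp at t
        · omega
        · exact hc t
        · omega
        · have := s.1 t; omega
  have htot : totalOcc (2 * K + 1) (3 * (L + 1)) C
      = K * (2 * (L + 1) + (2 * L + 3)) + 3 * (L + 1) := by
    unfold totalOcc
    rw [Finset.sum_Icc_succ_top (by omega), rowOcc_full _ _ _ hbot,
      total_aux _ (2 * (L + 1)) (2 * L + 3) K]
    · intro k hk
      apply rowOcc_leg
      have := hleg (K - 1 - k) (by omega)
      rwa [show 2 * K + 1 - 1 - 2 * (K - 1 - k) = 2 * k + 2 by omega] at this
    · intro k hk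
      have := hpair (K - k) (by omega) (by omega)
      rw [show 2 * K + 1 - 2 * (K - k) = 2 * k + 1 by omega] at this
      obtain ⟨a, b, c, d⟩ := this
      have e : rowOcc (3 * (L + 1)) C (2 * k + 1) = rowOcc (3 * L + 2) C (2 * k + 1)
          + (C (2 * k + 1) (3 * (L + 1))).toNat := rowOcc_succ (3 * L + 2) C _
      rw [e, b, rowOcc_pair L C _ a (fun j j1 j2 j3 => c j j1 (by omega) j3)
        (fun l l1 l2 => d l l1 (by omega))]
      simp
  refine ⟨⟨L + 1, rfl⟩, ⟨K, rfl⟩, ?_, ?_, hleg, hbot, hpair⟩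
  · rw [htot]; push_cast; ring
  · rw [htot]; push_cast; ring
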